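/- (Multi-secant BFGS update.) Let M be a symmetric positive definite d×d matrix, H₀ a symmetric d×d matrix, and let A = YC and B = RC be d×(N−1) matrices with B of full column rank and AᵀB = BᵀA. Define B⁺ = (BᵀMB)⁻¹BᵀM and P = BB⁺. Then the matrix H* = AB⁺ + (AB⁺)ᵀ(I − P) + (I − P)ᵀH₀(I − P) is symmetric, satisfies H*B = A, and is the unique minimizer of H ↦ ‖H − H₀‖_{M⁻¹}² over the set {H ∈ ℝ^{d×d} : HB = A, H = Hᵀ}. -/

import Mathlib

open Matrix

/-- Squared weighted Frobenius norm `‖X‖_M² = Tr(M Xᵀ M X)`. -/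
noncomputable def frobSq {d : ℕ} (M X : Matrix (Fin d) (Fin d) ℝ) : ℝ :=
  Matrix.trace (M * Xᵀ * M * X)

open scoped MatrixOrder in
theorem frobSq_eq_trace_conjTranspose_mul_self {d : ℕ} {W : Matrix (Fin d) (Fin d) ℝ}
    (hW : W.PosDef) :
    ∃ F : Matrix (Fin d) (Fin d) ℝ, IsUnit F ∧
      ∀ X, frobSq W X = ((F * X * Fᴴ)ᴴ * (F * X * Fᴴ)).trace := by
  obtain ⟨F, hF, rfl⟩ :=
    CStarAlgebra.isStrictlyPositive_iff_eq_star_mul_self.mp hW.isStrictlyPositive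
  refine ⟨F, hF, fun X => ?_⟩
  rw [frobSq, star_eq_conjTranspose, ← conjTranspose_eq_transpose_of_trivial X]
  simp only [conjTranspose_mul, conjTranspose_conjTranspose, Matrix.mul_assoc]
  rw [trace_mul_comm]
  simp only [Matrix.mul_assoc]

theorem frobSq_nonneg {d : ℕ} {W : Matrix (Fin d) (Fin d) ℝ} (hW : W.PosDef)
    (X : Matrix (Fin d) (Fin d) ℝ) : 0 ≤ frobSq W X := by
  obtain ⟨F, -, h⟩ := frobSq_eq_trace_conjTranspose_mul_self hW
  rw [h]
  exact (posSemidef_conjTranspose_mul_self _).trace_nonneg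

theorem frobSq_eq_zero {d : ℕ} {W : Matrix (Fin d) (Fin d) ℝ} (hW : W.PosDef)
    {X : Matrix (Fin d) (Fin d) ℝ} (hX : frobSq W X = 0) : X = 0 := by
  obtain ⟨F, hF, h⟩ := frobSq_eq_trace_conjTranspose_mul_self hW
  rw [h, trace_conjTranspose_mul_self_eq_zero_iff] at hX
  have hF' : IsUnit Fᴴ := hF.star
  rwa [hF'.mul_left_eq_zero, hF.mul_right_eq_zero] at hX

theorem frobSq_add_of_orthogonal {d : ℕ} {W E D : Matrix (Fin d) (Fin d) ℝ}
    (hW : W.IsSymm) (hED : (W * Dᵀ * W * E).trace = 0) :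
    frobSq W (E + D) = frobSq W E + frobSq W D := by
  have hDE : (W * Eᵀ * W * D).trace = 0 := by
    rw [← hED, ← trace_transpose (W * Dᵀ * W * E)]
    simp only [transpose_mul, transpose_transpose, hW.eq]
    simp only [Matrix.mul_assoc]
    rw [trace_mul_comm]
    simp only [Matrix.mul_assoc]
  simp only [frobSq, transpose_add, Matrix.mul_add, Matrix.add_mul, trace_add, hED, hDE]
  ring

/-- multi-secant BFGS update: with `M` symmetric positive definite, `H₀`
symmetric, `A = YC`, `B = RC` of full column rank, `AᵀB = BᵀA`,
`B⁺ = (BᵀMB)⁻¹BᵀM` and `P = BB⁺`, the matrix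
`H* = AB⁺ + (AB⁺)ᵀ(I − P) + (I − P)ᵀH₀(I − P)` is symmetric, satisfies `H*B = A`, and
is the unique minimizer of `H ↦ ‖H − H₀‖_{M⁻¹}²` over `{H : HB = A, H = Hᵀ}`. -/
theorem stmt16 {d N : ℕ}
    (M : Matrix (Fin d) (Fin d) ℝ) (hM : M.PosDef)
    (H₀ : Matrix (Fin d) (Fin d) ℝ) (hH₀ : H₀.IsSymm)
    (Y R : Matrix (Fin d) (Fin N) ℝ)
    (C : Matrix (Fin N) (Fin (N - 1)) ℝ)
    (hCrank : Function.Injective C.mulVec)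
    (hC1 : Cᵀ *ᵥ (fun _ => (1:ℝ)) = 0)
    (A B : Matrix (Fin d) (Fin (N - 1)) ℝ) (hA : A = Y * C) (hB : B = R * C)
    (hBrank : Function.Injective B.mulVec)
    (hsymm : Aᵀ * B = Bᵀ * A)
    (Bplus : Matrix (Fin (N - 1)) (Fin d) ℝ)
    (hBplus : Bplus = (Bᵀ * M * B)⁻¹ * (Bᵀ * M))
    (P : Matrix (Fin d) (Fin d) ℝ) (hP : P = B * Bplus)
    (Hstar : Matrix (Fin d) (Fin d) ℝ)
    (hHstar : Hstar = A * Bplus + (A * Bplus)ᵀ * (1 - P) + (1 - P)ᵀ * H₀ * (1 - P)) :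
    Hstar.IsSymm ∧ Hstar * B = A ∧
    (∀ H : Matrix (Fin d) (Fin d) ℝ, H * B = A → H.IsSymm →
      frobSq M⁻¹ (Hstar - H₀) ≤ frobSq M⁻¹ (H - H₀)) ∧
    (∀ H : Matrix (Fin d) (Fin d) ℝ, H * B = A → H.IsSymm →
      frobSq M⁻¹ (H - H₀) = frobSq M⁻¹ (Hstar - H₀) → H = Hstar) := by
  have hMs : Mᵀ = M := by
    simpa only [conjTranspose_eq_transpose_of_trivial] using hM.isHermitian.eq
  have hMu : IsUnit M.det := (isUnit_iff_isUnit_det _).mp hM.isUnit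
  have hSu : IsUnit (Bᵀ * M * B).det := by
    have h := (hM.conjTranspose_mul_mul_same hBrank).isUnit
    rwa [conjTranspose_eq_transpose_of_trivial, isUnit_iff_isUnit_det] at h
  have hW : M⁻¹.PosDef := hM.inv
  have hWs : M⁻¹.IsSymm := by
    rw [IsSymm, transpose_nonsing_inv, hMs]
  have hBB : Bplus * B = 1 := by
    rw [hBplus, Matrix.mul_assoc, nonsing_inv_mul _ hSu]
  have hPW : P * M⁻¹ = M⁻¹ * Pᵀ := by
    have hS : (Bᵀ * M * B)ᵀ = Bᵀ * M * B := by
      simp only [transpose_mul, transpose_transpose, hMs, Matrix.mul_assoc]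
    have h1 : P * M⁻¹ = B * (Bᵀ * M * B)⁻¹ * Bᵀ := by
      rw [hP, hBplus]
      rw [Matrix.mul_assoc B, Matrix.mul_assoc _ (Bᵀ * M), mul_nonsing_inv_cancel_right _ _ hMu,
        Matrix.mul_assoc B]
    have h2 : (P * M⁻¹)ᵀ = P * M⁻¹ := by
      rw [h1, transpose_mul, transpose_mul, transpose_nonsing_inv, hS, transpose_transpose,
        ← Matrix.mul_assoc]
    rw [← h2, transpose_mul, hWs.eq]
  obtain ⟨Q, hQ⟩ : ∃ Q, Q = 1 - P := ⟨_, rfl⟩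
  rw [← hQ] at hHstar
  have hQB : Q * B = 0 := by
    rw [hQ, hP, Matrix.sub_mul, Matrix.mul_assoc, hBB, Matrix.one_mul, Matrix.mul_one, sub_self]
  have hBQ : Bplus * Q = 0 := by
    rw [hQ, hP, Matrix.mul_sub, ← Matrix.mul_assoc, hBB, Matrix.one_mul, Matrix.mul_one, sub_self]
  have hQQ : Q * Q = Q := by
    nth_rw 2 [hQ]
    rw [hP, Matrix.mul_sub, ← Matrix.mul_assoc, hQB, Matrix.zero_mul, Matrix.mul_one, sub_zero]
  have hQW : Q * M⁻¹ = M⁻¹ * Qᵀ := by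
    rw [hQ, transpose_sub, transpose_one, Matrix.sub_mul, Matrix.mul_sub, hPW, Matrix.one_mul,
      Matrix.mul_one]
  have hsym : Hstar.IsSymm := by
    have hABP : (A * Bplus)ᵀ * P = Pᵀ * (A * Bplus) := by
      simp only [hP, transpose_mul, Matrix.mul_assoc]
      rw [← Matrix.mul_assoc Aᵀ, hsymm, Matrix.mul_assoc]
    have h : Hstar = A * Bplus + (A * Bplus)ᵀ - (A * Bplus)ᵀ * P + Qᵀ * H₀ * Q := by
      rw [hHstar]
      nth_rw 1 [hQ]
      rw [Matrix.mul_sub, Matrix.mul_one, add_sub_assoc]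
    have h1 : ((A * Bplus)ᵀ * P)ᵀ = (A * Bplus)ᵀ * P := by
      rw [transpose_mul, transpose_transpose, hABP]
    have h2 : (Qᵀ * H₀ * Q)ᵀ = Qᵀ * H₀ * Q := by
      rw [transpose_mul, transpose_mul, transpose_transpose, hH₀.eq, Matrix.mul_assoc]
    rw [IsSymm, h, transpose_add, transpose_sub, transpose_add, transpose_transpose, h1, h2,
      add_comm (A * Bplus)]
  have hsec : Hstar * B = A := by
    simp only [hHstar, Matrix.add_mul, Matrix.mul_assoc, hQB, hBB, Matrix.mul_zero,
      Matrix.mul_one, add_zero]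
  have hQE : Qᵀ * (Hstar - H₀) * Q = 0 := by
    have hQBt : Qᵀ * Bplusᵀ = 0 := by rw [← transpose_mul, hBQ, transpose_zero]
    have hQQt : Qᵀ * Qᵀ = Qᵀ := by rw [← transpose_mul, hQQ]
    have h : Qᵀ * Hstar * Q = Qᵀ * H₀ * Q := by
      have e1 : Qᵀ * (A * Bplus) * Q = 0 := by
        simp only [Matrix.mul_assoc, hBQ, Matrix.mul_zero]
      have e2 : Qᵀ * ((A * Bplus)ᵀ * Q) * Q = 0 := by
        simp only [transpose_mul, ← Matrix.mul_assoc, hQBt, Matrix.zero_mul]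
      have e3 : Qᵀ * (Qᵀ * H₀ * Q) * Q = Qᵀ * H₀ * Q := by
        rw [Matrix.mul_assoc Qᵀ (Qᵀ * H₀ * Q), Matrix.mul_assoc (Qᵀ * H₀), hQQ,
          ← Matrix.mul_assoc, ← Matrix.mul_assoc, hQQt]
      rw [hHstar, Matrix.mul_add, Matrix.mul_add, Matrix.add_mul, Matrix.add_mul, e1, e2, e3,
        zero_add, zero_add]
    rw [Matrix.mul_sub, Matrix.sub_mul, h, sub_self]
  have key : ∀ H : Matrix (Fin d) (Fin d) ℝ, H * B = A → H.IsSymm →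
      frobSq M⁻¹ (H - H₀) = frobSq M⁻¹ (Hstar - H₀) + frobSq M⁻¹ (H - Hstar) := by
    intro H hHB hHs
    obtain ⟨D, hD⟩ : ∃ D, D = H - Hstar := ⟨_, rfl⟩
    have hDs : Dᵀ = D := by rw [hD, transpose_sub, hHs.eq, hsym.eq]
    have hDB : D * B = 0 := by rw [hD, Matrix.sub_mul, hHB, hsec, sub_self]
    have hDQ : D * Q = D := by
      rw [hQ, hP, Matrix.mul_sub, ← Matrix.mul_assoc, hDB, Matrix.zero_mul, Matrix.mul_one,
        sub_zero]
    have hQD : Qᵀ * D = D := by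
      rw [← hDs, ← transpose_mul, hDQ]
    have horth : (M⁻¹ * Dᵀ * M⁻¹ * (Hstar - H₀)).trace = 0 := by
      have h : M⁻¹ * D * M⁻¹ = Q * (M⁻¹ * D * M⁻¹) * Qᵀ := by
        calc M⁻¹ * D * M⁻¹ = M⁻¹ * (Qᵀ * (D * Q)) * M⁻¹ := by rw [hDQ, hQD]
          _ = (M⁻¹ * Qᵀ) * D * (Q * M⁻¹) := by simp only [Matrix.mul_assoc]
          _ = Q * (M⁻¹ * D * M⁻¹) * Qᵀ := by
            rw [← hQW]
            nth_rw 2 [hQW]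
            simp only [Matrix.mul_assoc]
      rw [hDs, h, Matrix.mul_assoc, Matrix.mul_assoc, trace_mul_comm, Matrix.mul_assoc, hQE,
        Matrix.mul_zero, trace_zero]
    rw [← hD, ← frobSq_add_of_orthogonal hWs horth, hD]
    congr 1
    abel
  refine ⟨hsym, hsec, fun H hHB hHs => ?_, fun H hHB hHs heq => ?_⟩
  · rw [key H hHB hHs]
    exact le_add_of_nonneg_right (frobSq_nonneg hW _)
  · rw [key H hHB hHs, add_eq_left] at heq
    exact sub_eq_zero.mp (frobSq_eq_zero hW heq)
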